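/- Let C be a conjugacy class of a finite Coxeter group W. For w ∈ C_min let π(w) = (J(w), C'_w), where C'_w is the conjugacy class of w in the parabolic subgroup W_{J(w)}. Then: (i) for every w ∈ C_min, the class C'_w is cuspidal in W_{J(w)}, so π(w) ∈ 𝓘(W,S); (ii) for any w, w' ∈ C_min one has π(w) ∼ π(w'); and (iii) every pair in 𝓘(W,S) that is ∼-equivalent to π(w) for some w ∈ C_min is itself of the form π(w') for some w' ∈ C_min. In other words, the pairs π(w), w ∈ C_min, form a full equivalence class in 𝓘(W,S). -/

import Mathlib

/-- The standard parabolic subgroup `W_I` of a Coxeter system. -/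
def CoxeterSystem.parabolic {B W : Type*} [Group W] {M : CoxeterMatrix B}
    (cs : CoxeterSystem M W) (I : Set B) : Subgroup W :=
  Subgroup.closure (cs.simple '' I)

/-- `C` is a conjugacy class of `W`. -/
def IsConjClassSet {W : Type*} [Group W] (C : Set W) : Prop :=
  ∃ w : W, C = {x | IsConj w x}

/-- The set of elements of minimal length in `C`. -/
def CoxeterSystem.Cmin {B W : Type*} [Group W] {M : CoxeterMatrix B}
    (cs : CoxeterSystem M W) (C : Set W) : Set W :=
  {w ∈ C | ∀ x ∈ C, cs.length w ≤ cs.length x}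

/-- `J(w)`: the set of generators occurring in some (equivalently, any) reduced
expression of `w`. -/
def CoxeterSystem.Jset {B W : Type*} [Group W] {M : CoxeterMatrix B}
    (cs : CoxeterSystem M W) (w : W) : Set B :=
  {i | ∃ ω : List B, cs.IsReduced ω ∧ cs.wordProd ω = w ∧ i ∈ ω}

/-- The conjugacy class of `w` under conjugation by a subgroup `H` (as a subset of `W`). -/
def conjClassIn {W : Type*} [Group W] (H : Subgroup W) (w : W) : Set W :=
  {x | ∃ y ∈ H, y * w * y⁻¹ = x}

/-- `(I, C')` belongs to `𝓘(W,S)`: `C'` is a conjugacy class of `W_I` which is cuspidal in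
`W_I`, i.e. `C' ∩ (W_I)_K = ∅` for every proper `K ⊊ I`. -/
def CoxeterSystem.IsCuspidalPair {B W : Type*} [Group W] {M : CoxeterMatrix B}
    (cs : CoxeterSystem M W) (I : Set B) (C' : Set W) : Prop :=
  (∃ w ∈ cs.parabolic I, C' = conjClassIn (cs.parabolic I) w) ∧
  ∀ K : Set B, K ⊂ I → ∀ x ∈ C', x ∉ cs.parabolic K

/-- The equivalence `(I₁,C₁') ∼ (I₂,C₂')` on pairs: there is `x ∈ W` with
`I₂ = x I₁ x⁻¹` (as sets of simple reflections) and `C₂' = x C₁' x⁻¹`. -/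
def CoxeterSystem.PairEquiv {B W : Type*} [Group W] {M : CoxeterMatrix B}
    (cs : CoxeterSystem M W) (p q : Set B × Set W) : Prop :=
  ∃ x : W, cs.simple '' q.1 = (fun g => x * g * x⁻¹) '' (cs.simple '' p.1) ∧
    q.2 = (fun g => x * g * x⁻¹) '' p.2

/-- The pair `π(w) = (J(w), conjugacy class of w in W_{J(w)})` attached to `w`. -/
def CoxeterSystem.minPair {B W : Type*} [Group W] {M : CoxeterMatrix B}
    (cs : CoxeterSystem M W) (w : W) : Set B × Set W :=
  (cs.Jset w, conjClassIn (cs.parabolic (cs.Jset w)) w)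


open Polynomial.Chebyshev in
/-- If `f y * g x = 4 cos² (π / m)`, then the product of the two reflections has order
dividing `m`, for `m ≥ 3`. -/
theorem reflection_mul_reflection_pow_eq_one {V : Type*} [AddCommGroup V] [Module ℝ V]
    {x y : V} {f g : Module.Dual ℝ V} (hf : f x = 2) (hg : g y = 2) {m : ℕ} (hm : 3 ≤ m)
    (h : f y * g x = 4 * Real.cos (Real.pi / m) ^ 2) :
    (Module.reflection hf * Module.reflection hg) ^ m = 1 := by
  have hm0 : (0 : ℝ) < m := by positivity
  have hm3 : (3 : ℝ) ≤ m := by exact_mod_cast hm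
  set θ : ℝ := 2 * (Real.pi / m) with hθ
  have ht : 2 * Real.cos θ = f y * g x - 2 := by
    rw [h, hθ, Real.cos_two_mul]; ring
  have hsin : Real.sin θ ≠ 0 := by
    refine (Real.sin_pos_of_pos_of_lt_pi (by positivity) ?_).ne'
    rw [hθ, ← mul_div_assoc, div_lt_iff₀ hm0]
    nlinarith [Real.pi_pos]
  have hS (n : ℤ) : (S ℝ n).eval (2 * Real.cos θ) * Real.sin θ = Real.sin ((n + 1) * θ) :=
    S_two_mul_real_cos θ n
  ext z
  rw [Module.reflection_mul_reflection_pow_apply hf hg m z _ ht]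
  rcases Nat.even_or_odd' m with ⟨k, hk | hk⟩
  · have h0 : (S ℝ ((k : ℤ) - 1)).eval (2 * Real.cos θ) = 0 := by
      have h1 := hS (k - 1)
      have h2 : (((k - 1 : ℤ) : ℝ) + 1) * θ = Real.pi := by
        have : θ * m = 2 * Real.pi := by rw [hθ]; field_simp
        rw [hk] at this
        push_cast at *
        linarith
      rw [h2, Real.sin_pi] at h1
      exact (mul_eq_zero.mp h1).resolve_right hsin
    rw [show ((m : ℤ) - 2) / 2 = k - 1 by lia, show ((m : ℤ) - 1) / 2 = k - 1 by lia, h0]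
    simp
  · have h0 : (S ℝ (k : ℤ)).eval (2 * Real.cos θ)
        + (S ℝ ((k : ℤ) - 1)).eval (2 * Real.cos θ) = 0 := by
      have h1 := hS (k - 1)
      have h2 := hS k
      have h3 : (((k : ℤ) : ℝ) + 1) * θ = 2 * Real.pi - (((k - 1 : ℤ) : ℝ) + 1) * θ := by
        have : θ * m = 2 * Real.pi := by rw [hθ]; field_simp
        rw [hk] at this
        push_cast at *
        linarith
      rw [h3, Real.sin_two_pi_sub, ← h1] at h2
      have : ((S ℝ (k : ℤ)).eval (2 * Real.cos θ)
        + (S ℝ ((k : ℤ) - 1)).eval (2 * Real.cos θ)) * Real.sin θ = 0 := by linarith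
      exact (mul_eq_zero.mp this).resolve_right hsin
    rw [show ((m : ℤ) - 2) / 2 = k - 1 by lia, show ((m : ℤ) - 1) / 2 = k by lia,
      show ((m : ℤ) - 3) / 2 = k - 1 by lia, show (m : ℤ) / 2 = k by lia, h0]
    simp

/-- The simple coroot of index `i` in the geometric representation. -/
noncomputable def CoxeterMatrix.coroot {B : Type*} (M : CoxeterMatrix B) (i : B) :
    Module.Dual ℝ (B →₀ ℝ) :=
  Finsupp.linearCombination ℝ fun j => -2 * Real.cos (Real.pi / M i j)

theorem CoxeterMatrix.coroot_single {B : Type*} (M : CoxeterMatrix B) (i j : B) :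
    M.coroot i (Finsupp.single j 1) = -2 * Real.cos (Real.pi / M i j) := by
  simp [CoxeterMatrix.coroot]

theorem CoxeterMatrix.coroot_self {B : Type*} (M : CoxeterMatrix B) (i : B) :
    M.coroot i (Finsupp.single i 1) = 2 := by
  simp [M.coroot_single]

/-- The geometric representation satisfies the Coxeter relations. -/
theorem CoxeterMatrix.isLiftable_reflection {B : Type*} (M : CoxeterMatrix B) :
    M.IsLiftable fun i => Module.reflection (M.coroot_self i) := by
  intro i j
  by_cases hij : i = j
  · subst hij
    rw [M.diagonal, pow_one]
    ext1 z
    exact Module.involutive_reflection (M.coroot_self i) z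
  have h1 := M.off_diagonal i j hij
  have hs : M j i = M i j := M.symmetric j i
  rcases Nat.lt_or_ge (M i j) 3 with h | h
  · obtain h0 | h2 : M i j = 0 ∨ M i j = 2 := by lia
    · rw [h0, pow_zero]
    · have hji : M.coroot j (Finsupp.single i 1) = 0 := by
        simp [M.coroot_single, hs, h2]
      have hij : M.coroot i (Finsupp.single j 1) = 0 := by
        simp [M.coroot_single, h2]
      rw [h2]
      ext1 z
      simp only [pow_two, LinearEquiv.mul_apply, Module.reflection_apply, map_sub, map_smul,
        hji, hij, M.coroot_self, LinearEquiv.coe_one, id]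
      module
  · refine reflection_mul_reflection_pow_eq_one _ _ h ?_
    rw [M.coroot_single, M.coroot_single, hs]
    ring

namespace CoxeterSystem

variable {B W : Type*} [Group W] {M : CoxeterMatrix B} (cs : CoxeterSystem M W)

/-! ### The geometric representation -/

/-- The geometric representation of a Coxeter group. -/
noncomputable def geometricRep : W →* ((B →₀ ℝ) ≃ₗ[ℝ] (B →₀ ℝ)) :=
  cs.lift ⟨_, M.isLiftable_reflection⟩

theorem geometricRep_simple (i : B) (v : B →₀ ℝ) :
    cs.geometricRep (cs.simple i) v = v - M.coroot i v • Finsupp.single i 1 := by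
  rw [geometricRep, lift_apply_simple, Module.reflection_apply]

theorem simple_mem_parabolic {I : Set B} {i : B} (hi : i ∈ I) :
    cs.simple i ∈ cs.parabolic I :=
  Subgroup.subset_closure ⟨i, hi, rfl⟩

theorem wordProd_mem_parabolic {I : Set B} {ω : List B} (h : ∀ i ∈ ω, i ∈ I) :
    cs.wordProd ω ∈ cs.parabolic I := by
  induction ω with
  | nil => simp [one_mem]
  | cons i ω ih =>
    rw [wordProd_cons]
    exact mul_mem (cs.simple_mem_parabolic (h i (by simp)))
      (ih fun j hj => h j (by simp [hj]))

theorem exists_word_of_mem_parabolic {I : Set B} {w : W} (hw : w ∈ cs.parabolic I) :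
    ∃ ω : List B, (∀ i ∈ ω, i ∈ I) ∧ cs.wordProd ω = w := by
  induction hw using Subgroup.closure_induction with
  | mem x hx =>
    obtain ⟨i, hi, rfl⟩ := hx
    exact ⟨[i], by simpa using hi, by simp⟩
  | one => exact ⟨[], by simp, by simp⟩
  | mul x y _ _ hx hy =>
    obtain ⟨ω, hω, rfl⟩ := hx
    obtain ⟨ω', hω', rfl⟩ := hy
    refine ⟨ω ++ ω', fun i hi => ?_, cs.wordProd_append _ _⟩
    exact (List.mem_append.mp hi).elim (hω i) (hω' i)
  | inv x _ hx =>
    obtain ⟨ω, hω, rfl⟩ := hx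
    exact ⟨ω.reverse, fun i hi => hω i (List.mem_reverse.mp hi), cs.wordProd_reverse ω⟩

theorem parabolic_mono {I J : Set B} (h : I ⊆ J) : cs.parabolic I ≤ cs.parabolic J :=
  Subgroup.closure_mono (Set.image_mono h)

theorem geometricRep_sub_mem_supported {I : Set B} {w : W} (hw : w ∈ cs.parabolic I)
    (v : B →₀ ℝ) : cs.geometricRep w v - v ∈ Finsupp.supported ℝ ℝ I := by
  obtain ⟨ω, hω, rfl⟩ := cs.exists_word_of_mem_parabolic hw
  induction ω with
  | nil => simp
  | cons i ω ih =>
    rw [wordProd_cons, map_mul, LinearEquiv.mul_apply, geometricRep_simple, sub_right_comm]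
    refine sub_mem (ih (fun j hj => hω j (by simp [hj])) (cs.wordProd_mem_parabolic
      fun j hj => hω j (by simp [hj]))) (Submodule.smul_mem _ _ ?_)
    exact Finsupp.single_mem_supported ℝ _ (hω i (by simp))

/-- A simple reflection lies in a standard parabolic subgroup only if it is one of the
given generators. -/
theorem simple_mem_parabolic_iff {I : Set B} {i : B} :
    cs.simple i ∈ cs.parabolic I ↔ i ∈ I := by
  refine ⟨fun h => ?_, cs.simple_mem_parabolic⟩
  have h1 := cs.geometricRep_sub_mem_supported h (Finsupp.single i 1)
  rw [geometricRep_simple, M.coroot_self, sub_sub_cancel_left, neg_mem_iff,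
    Finsupp.mem_supported] at h1
  apply h1
  simp

/-! ### The inversion cocycle and the strong exchange property -/

open Classical in
/-- The permutation of `W × ZMod 2` attached to a simple reflection `s`: it conjugates the
first component by `s`, and flips the second one when the first one is `s`. -/
noncomputable def inversionFlip (i : B) : Function.End (W × ZMod 2) := fun p =>
  (cs.simple i * p.1 * cs.simple i, p.2 + if p.1 = cs.simple i then 1 else 0)

theorem conj_simple_mul_simple_pow (i j : B) (n : ℕ) :
    cs.simple j * (cs.simple i * cs.simple j) ^ n
      = ((cs.simple i * cs.simple j) ^ n)⁻¹ * cs.simple j := by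
  induction n with
  | zero => simp
  | succ n ih =>
    rw [pow_succ, ← mul_assoc, ih, ← pow_succ, pow_succ']
    simp [mul_assoc]

open Classical in
theorem inversionFlip_mul_pow_apply (i j : B) (n : ℕ) (t : W) (e : ZMod 2) :
    ((cs.inversionFlip i * cs.inversionFlip j) ^ n) (t, e) =
      ((cs.simple i * cs.simple j) ^ n * t * ((cs.simple i * cs.simple j) ^ n)⁻¹,
        e + ∑ k ∈ Finset.range (2 * n),
          if t = cs.simple j * (cs.simple i * cs.simple j) ^ k then 1 else 0) := by
  induction n with
  | zero => rw [pow_zero]; simp [Function.End.one_def]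
  | succ n ih =>
    have h1 := cs.conj_simple_mul_simple_pow i j n
    have step : ((cs.inversionFlip i * cs.inversionFlip j) ^ (n + 1)) (t, e) =
        cs.inversionFlip i (cs.inversionFlip j
          (((cs.inversionFlip i * cs.inversionFlip j) ^ n) (t, e))) := by
      rw [pow_succ']; rfl
    rw [step, ih]
    have hi : cs.simple i = cs.simple i * cs.simple j * cs.simple j := by simp
    have hsj : (cs.simple i * cs.simple j)⁻¹ = cs.simple j * cs.simple i := by simp
    generalize ha : cs.simple i * cs.simple j = a at *
    have e1 : a ^ n * t * (a ^ n)⁻¹ = cs.simple j ↔ t = cs.simple j * a ^ (2 * n) := by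
      rw [mul_inv_eq_iff_eq_mul, ← eq_inv_mul_iff_mul_eq, ← mul_assoc, ← h1, mul_assoc,
        ← pow_add, ← two_mul]
    have e2 : cs.simple j * (a ^ n * t * (a ^ n)⁻¹) * cs.simple j = cs.simple i ↔
        t = cs.simple j * a ^ (2 * n + 1) := by
      rw [hi, mul_left_inj, ← eq_inv_mul_iff_mul_eq, inv_simple, mul_inv_eq_iff_eq_mul,
        ← eq_inv_mul_iff_mul_eq, mul_assoc, ← mul_assoc, ← h1, mul_assoc, ← pow_succ',
        ← pow_add, two_mul, add_assoc]
    refine Prod.ext ?_ ?_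
    · simp only [inversionFlip]
      rw [pow_succ' a n, mul_inv_rev, hsj]
      simp only [← ha, mul_assoc]
    · simp only [inversionFlip, e1, e2, Finset.sum_range_succ, Nat.mul_succ, ← add_assoc]

open Classical in
theorem isLiftable_inversionFlip : M.IsLiftable cs.inversionFlip := by
  intro i j
  funext ⟨t, e⟩
  rw [inversionFlip_mul_pow_apply, simple_mul_simple_pow, two_mul, Finset.sum_range_add]
  simp only [pow_add, simple_mul_simple_pow, one_mul, inv_one, mul_one]
  rw [CharTwo.add_self_eq_zero, add_zero]
  rfl

/-- The action of `W` on `W × ZMod 2` which records inversions in the second component. -/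
noncomputable def inversionAction : W →* Function.End (W × ZMod 2) :=
  cs.lift ⟨_, cs.isLiftable_inversionFlip⟩

/-- The inversion cocycle: on reflections `t`, it is the indicator function of the set of
right inversions of `w`. -/
noncomputable def inversionParity (w t : W) : ZMod 2 := (cs.inversionAction w (t, 0)).2

open Classical in
theorem inversionAction_simple (i : B) (p : W × ZMod 2) :
    cs.inversionAction (cs.simple i) p =
      (cs.simple i * p.1 * cs.simple i, p.2 + if p.1 = cs.simple i then 1 else 0) := by
  rw [inversionAction, lift_apply_simple]; rfl

theorem inversionAction_apply (w t : W) (e : ZMod 2) :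
    cs.inversionAction w (t, e) = (w * t * w⁻¹, e + cs.inversionParity w t) := by
  induction w using cs.simple_induction_left generalizing e with
  | one => simp [inversionParity, Function.End.one_def]
  | mul_simple_left w i ih =>
    have h (e : ZMod 2) : cs.inversionAction (cs.simple i * w) (t, e) =
        cs.inversionAction (cs.simple i) (cs.inversionAction w (t, e)) := by
      rw [map_mul]; rfl
    rw [inversionParity, h, h, ih, ih 0, inversionAction_simple, inversionAction_simple]
    simp [mul_assoc, add_assoc]

theorem inversionParity_mul (u v t : W) :
    cs.inversionParity (u * v) t = cs.inversionParity v t + cs.inversionParity u (v * t * v⁻¹) := by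
  have h : cs.inversionAction (u * v) (t, 0) =
      cs.inversionAction u (cs.inversionAction v (t, 0)) := by
    rw [map_mul]; rfl
  rw [inversionAction_apply, inversionAction_apply, inversionAction_apply] at h
  simpa using congrArg Prod.snd h

theorem inversionParity_one (t : W) : cs.inversionParity 1 t = 0 := by
  simp [inversionParity, Function.End.one_def]

open Classical in
theorem inversionParity_simple (i : B) (t : W) :
    cs.inversionParity (cs.simple i) t = if t = cs.simple i then 1 else 0 := by
  simp [inversionParity, inversionAction_simple]

theorem inversionParity_inv (w t : W) :
    cs.inversionParity w⁻¹ (w * t * w⁻¹) = cs.inversionParity w t := by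
  have h := cs.inversionParity_mul w⁻¹ w t
  rw [inv_mul_cancel, inversionParity_one] at h
  exact (CharTwo.add_eq_zero.mp h.symm).symm

theorem IsReflection.inversionParity_self {cs : CoxeterSystem M W} {t : W}
    (ht : cs.IsReflection t) : cs.inversionParity t t = 1 := by
  obtain ⟨w, i, rfl⟩ := ht
  rw [inversionParity_mul, inversionParity_inv, inversionParity_mul, inversionParity_simple,
    if_pos (by group)]
  have h : w⁻¹ * (w * cs.simple i * w⁻¹) * w⁻¹⁻¹ = cs.simple i := by group
  rw [h, mul_inv_cancel_right, add_left_comm, CharTwo.add_self_eq_zero, add_zero]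

theorem mem_rightInvSeq_of_inversionParity_ne_zero {ω : List B} {t : W}
    (h : cs.inversionParity (cs.wordProd ω) t ≠ 0) : t ∈ cs.rightInvSeq ω := by
  induction ω with
  | nil => simp [inversionParity_one] at h
  | cons i ω ih =>
    rw [wordProd_cons, inversionParity_mul, inversionParity_simple] at h
    rw [rightInvSeq, List.mem_cons]
    by_contra! hc
    rw [not_imp_comm.mp ih hc.2, zero_add, if_neg] at h
    · exact h rfl
    · intro h'
      apply hc.1
      rw [← h']
      group

theorem isRightInversion_of_inversionParity_ne_zero {w t : W}
    (h : cs.inversionParity w t ≠ 0) : cs.IsRightInversion w t := by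
  obtain ⟨ω, hω, rfl⟩ := cs.exists_isReduced w
  exact cs.isRightInversion_of_mem_rightInvSeq hω
    (cs.mem_rightInvSeq_of_inversionParity_ne_zero h)

theorem isRightInversion_iff_inversionParity {w t : W} (ht : cs.IsReflection t) :
    cs.IsRightInversion w t ↔ cs.inversionParity w t ≠ 0 := by
  refine ⟨fun h h0 => ?_, cs.isRightInversion_of_inversionParity_ne_zero⟩
  have h1 : cs.inversionParity (w * t) t = 1 := by
    rw [inversionParity_mul, ht.inversionParity_self, mul_inv_cancel_right, h0, add_zero]
  exact ht.isRightInversion_mul_left_iff.mp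
    (cs.isRightInversion_of_inversionParity_ne_zero (h1 ▸ one_ne_zero)) h

/-- The strong exchange property. -/
theorem IsRightInversion.mem_rightInvSeq {cs : CoxeterSystem M W} {ω : List B} {t : W}
    (h : cs.IsRightInversion (cs.wordProd ω) t) : t ∈ cs.rightInvSeq ω :=
  cs.mem_rightInvSeq_of_inversionParity_ne_zero
    ((cs.isRightInversion_iff_inversionParity h.1).mp h)

theorem mem_rightInvSeq_iff {ω : List B} (hω : cs.IsReduced ω) {t : W} :
    t ∈ cs.rightInvSeq ω ↔ cs.IsRightInversion (cs.wordProd ω) t :=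
  ⟨cs.isRightInversion_of_mem_rightInvSeq hω, IsRightInversion.mem_rightInvSeq⟩

theorem finite_setOf_isRightInversion (w : W) : {t | cs.IsRightInversion w t}.Finite := by
  obtain ⟨ω, hω, rfl⟩ := cs.exists_isReduced w
  exact (cs.rightInvSeq ω).finite_toSet.subset fun t => IsRightInversion.mem_rightInvSeq

/-- The length of `w` is the number of its inversions. -/
theorem ncard_setOf_isRightInversion (w : W) :
    {t | cs.IsRightInversion w t}.ncard = cs.length w := by
  classical
  obtain ⟨ω, hω, rfl⟩ := cs.exists_isReduced w
  have : {t | cs.IsRightInversion (cs.wordProd ω) t} = ((cs.rightInvSeq ω).toFinset : Set W) := by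
    ext t
    simp [cs.mem_rightInvSeq_iff hω]
  rw [this, Set.ncard_coe_finset, List.toFinset_card_of_nodup hω.nodup_rightInvSeq,
    length_rightInvSeq, hω.eq]

/-! ### Parabolic subgroups -/

theorem mem_of_mem_rightInvSeq {H : Subgroup W} {ω : List B}
    (h : ∀ i ∈ ω, cs.simple i ∈ H) {t : W} (ht : t ∈ cs.rightInvSeq ω) : t ∈ H := by
  have hprod (ω : List B) (h : ∀ i ∈ ω, cs.simple i ∈ H) : cs.wordProd ω ∈ H := by
    rw [wordProd]
    exact H.list_prod_mem (by simpa using h)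
  induction ω with
  | nil => simp at ht
  | cons i ω ih =>
    have htail : ∀ j ∈ ω, cs.simple j ∈ H := fun j hj => h j (by simp [hj])
    rw [rightInvSeq, List.mem_cons] at ht
    rcases ht with rfl | ht
    · exact mul_mem (mul_mem (inv_mem (hprod ω htail)) (h i (by simp))) (hprod ω htail)
    · exact ih htail ht

/-- The letters of a word lie in any subgroup containing its inversion sequence. -/
theorem simple_mem_of_rightInvSeq_subset {H : Subgroup W} {ω : List B}
    (h : ∀ t ∈ cs.rightInvSeq ω, t ∈ H) : ∀ i ∈ ω, cs.simple i ∈ H := by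
  induction ω with
  | nil => simp
  | cons i ω ih =>
    rw [rightInvSeq] at h
    have h' : ∀ j ∈ ω, cs.simple j ∈ H := ih fun t ht => h t (by simp [ht])
    have hω : cs.wordProd ω ∈ H := by
      rw [wordProd]
      exact H.list_prod_mem (by simpa using h')
    have hi := mul_mem (mul_mem hω (h _ List.mem_cons_self)) (inv_mem hω)
    intro j hj
    rcases List.mem_cons.mp hj with rfl | hj
    · simpa [mul_assoc] using hi
    · exact h' j hj

theorem IsRightInversion.mem_parabolic {cs : CoxeterSystem M W} {I : Set B} {w t : W}
    (hw : w ∈ cs.parabolic I) (h : cs.IsRightInversion w t) : t ∈ cs.parabolic I := by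
  obtain ⟨ω, hω, rfl⟩ := cs.exists_word_of_mem_parabolic hw
  exact cs.mem_of_mem_rightInvSeq (fun i hi => cs.simple_mem_parabolic (hω i hi))
    h.mem_rightInvSeq

theorem simple_mem_of_forall_isRightInversion {H : Subgroup W} {w : W}
    (h : ∀ t, cs.IsRightInversion w t → t ∈ H) {i : B} (hi : i ∈ cs.Jset w) :
    cs.simple i ∈ H := by
  obtain ⟨ω, hω, rfl, hi⟩ := hi
  exact cs.simple_mem_of_rightInvSeq_subset
    (fun t ht => h t (cs.isRightInversion_of_mem_rightInvSeq hω ht)) i hi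

theorem Jset_subset_of_mem_parabolic {I : Set B} {w : W} (hw : w ∈ cs.parabolic I) :
    cs.Jset w ⊆ I := fun _ hi => cs.simple_mem_parabolic_iff.mp
  (cs.simple_mem_of_forall_isRightInversion (fun _ ht => ht.mem_parabolic hw) hi)

theorem exists_reduced_word_Jset (w : W) :
    ∃ ω : List B, cs.IsReduced ω ∧ cs.wordProd ω = w ∧ ∀ i ∈ ω, i ∈ cs.Jset w := by
  obtain ⟨ω, hω, rfl⟩ := cs.exists_isReduced w
  exact ⟨ω, hω, rfl, fun i hi => ⟨ω, hω, rfl, hi⟩⟩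

theorem mem_parabolic_Jset (w : W) : w ∈ cs.parabolic (cs.Jset w) := by
  obtain ⟨ω, -, h, hJ⟩ := cs.exists_reduced_word_Jset w
  rw [← h] at hJ ⊢
  exact cs.wordProd_mem_parabolic hJ

/-! ### Minimal coset representatives -/

/-- `x` has minimal length in the coset `x W_I`. -/
def IsMinCosetRep (I : Set B) (x : W) : Prop :=
  ∀ u ∈ cs.parabolic I, cs.length x ≤ cs.length (x * u)

theorem exists_isMinCosetRep (I : Set B) (z : W) :
    ∃ x, ∃ u ∈ cs.parabolic I, z = x * u ∧ cs.IsMinCosetRep I x := by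
  obtain ⟨u, hu, hmin⟩ := WellFounded.has_min
    (InvImage.wf (fun u => cs.length (z * u)) Nat.lt_wfRel.wf) (cs.parabolic I : Set W)
    ⟨1, one_mem _⟩
  refine ⟨z * u, u⁻¹, inv_mem hu, by simp, fun v hv => ?_⟩
  rw [mul_assoc]
  exact not_lt.mp (hmin (u * v) (mul_mem hu hv))

variable {cs} in
/-- Conjugation by a minimal coset representative sends inversions to inversions. -/
theorem IsMinCosetRep.isRightInversion_conj {I : Set B} {x v t : W}
    (hx : cs.IsMinCosetRep I x) (hv : v ∈ cs.parabolic I) (ht : cs.IsRightInversion v t) :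
    cs.IsRightInversion (x * v * x⁻¹) (x * t * x⁻¹) := by
  have h0 {r : W} (hr : r ∈ cs.parabolic I) : cs.inversionParity x r = 0 := by
    by_contra hne
    exact (cs.isRightInversion_of_inversionParity_ne_zero hne).2.not_ge (hx r hr)
  have htI := ht.mem_parabolic hv
  apply cs.isRightInversion_of_inversionParity_ne_zero
  rw [inversionParity_mul, inversionParity_inv, h0 htI, zero_add, inversionParity_mul]
  simp only [mul_assoc, inv_inv, inv_mul_cancel_left, inv_mul_cancel, mul_one]
  rw [h0 (mul_mem hv (mul_mem htI (inv_mem hv))), add_zero]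
  exact (cs.isRightInversion_iff_inversionParity ht.1).mp ht

variable {cs} in
theorem IsMinCosetRep.image_subset {I : Set B} {x v : W}
    (hx : cs.IsMinCosetRep I x) (hv : v ∈ cs.parabolic I) :
    (fun t => x * t * x⁻¹) '' {t | cs.IsRightInversion v t} ⊆
      {t | cs.IsRightInversion (x * v * x⁻¹) t} :=
  Set.image_subset_iff.mpr fun _ ht => hx.isRightInversion_conj hv ht

variable {cs} in
theorem IsMinCosetRep.ncard_image {x v : W} :
    ((fun t => x * t * x⁻¹) '' {t | cs.IsRightInversion v t}).ncard = cs.length v := by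
  rw [← cs.ncard_setOf_isRightInversion v]
  exact Set.ncard_image_of_injective _ (MulAut.conj x).injective

variable {cs} in
theorem IsMinCosetRep.length_le_length_conj {I : Set B} {x v : W}
    (hx : cs.IsMinCosetRep I x) (hv : v ∈ cs.parabolic I) :
    cs.length v ≤ cs.length (x * v * x⁻¹) := by
  rw [← ncard_image (x := x), ← ncard_setOf_isRightInversion]
  exact Set.ncard_le_ncard (hx.image_subset hv) (cs.finite_setOf_isRightInversion _)

variable {cs} in
/-- If conjugation by a minimal coset representative does not increase the length, then all
generators occurring in the conjugate lie in the conjugate parabolic subgroup. -/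
theorem IsMinCosetRep.conj_simple_mem {I : Set B} {x v : W}
    (hx : cs.IsMinCosetRep I x) (hv : v ∈ cs.parabolic I)
    (h : cs.length (x * v * x⁻¹) ≤ cs.length v) {i : B} (hi : i ∈ cs.Jset (x * v * x⁻¹)) :
    x⁻¹ * cs.simple i * x ∈ cs.parabolic I := by
  have heq := Set.eq_of_subset_of_ncard_le (hx.image_subset hv)
    (by rwa [ncard_image, ncard_setOf_isRightInversion]) (cs.finite_setOf_isRightInversion _)
  have key := cs.simple_mem_of_forall_isRightInversion
    (H := (cs.parabolic I).comap (MulAut.conj x⁻¹).toMonoidHom) (w := x * v * x⁻¹) ?_ hi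
  · simpa using key
  · intro t ht
    obtain ⟨r, hr, rfl⟩ := heq.symm.subset ht
    simpa [mul_assoc] using IsRightInversion.mem_parabolic hv hr

/-! ### Elements of minimal length in a conjugacy class -/

/-- An element of minimal length in its conjugacy class which is conjugate to an element of
`W_I` is so through a minimal coset representative `x`, for which `x⁻¹ W_{J(w)} x ≤ W_I`. -/
theorem exists_isMinCosetRep_conj {I : Set B} {w v z : W} (hv : v ∈ cs.parabolic I)
    (hw : ∀ y, cs.length w ≤ cs.length (y * w * y⁻¹)) (hz : w = z * v * z⁻¹) :
    ∃ x, ∃ u ∈ cs.parabolic I, w = x * (u * v * u⁻¹) * x⁻¹ ∧ cs.IsMinCosetRep I x ∧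
      ∀ y ∈ cs.parabolic (cs.Jset w), x⁻¹ * y * x ∈ cs.parabolic I := by
  obtain ⟨x, u, hu, rfl, hx⟩ := cs.exists_isMinCosetRep I z
  have hw' : w = x * (u * v * u⁻¹) * x⁻¹ := by rw [hz]; group
  have hv' := mul_mem (mul_mem hu hv) (inv_mem hu)
  refine ⟨x, u, hu, hw', hx, ?_⟩
  have hle : cs.parabolic (cs.Jset w) ≤
      (cs.parabolic I).comap (MulAut.conj x⁻¹).toMonoidHom := by
    rw [parabolic, Subgroup.closure_le]
    rintro _ ⟨i, hi, rfl⟩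
    have hlen : cs.length (x * (u * v * u⁻¹) * x⁻¹) ≤ cs.length (u * v * u⁻¹) := by
      have := hw x⁻¹
      rw [← hw']
      nth_rw 2 [hw'] at this
      simpa [mul_assoc] using this
    rw [hw'] at hi
    simpa using hx.conj_simple_mem hv' hlen hi
  intro y hy
  simpa using hle hy

theorem card_parabolic_le_of_conj [Finite W] {I J : Set B} {x : W}
    (h : ∀ y ∈ cs.parabolic J, x⁻¹ * y * x ∈ cs.parabolic I) :
    Nat.card (cs.parabolic J) ≤ Nat.card (cs.parabolic I) := by
  refine Nat.card_le_card_of_injective (fun y => ⟨x⁻¹ * y.1 * x, h _ y.2⟩) fun y y' hy => ?_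
  simpa using hy

theorem length_le_conj_of_mem_Cmin {C : Set W} (hC : IsConjClassSet C) {w : W}
    (hw : w ∈ cs.Cmin C) (y : W) : cs.length w ≤ cs.length (y * w * y⁻¹) := by
  obtain ⟨c, rfl⟩ := hC
  exact hw.2 _ (hw.1.trans (isConj_iff.mpr ⟨y, rfl⟩))

theorem isCuspidalPair_minPair [Finite W] {w : W}
    (hw : ∀ y, cs.length w ≤ cs.length (y * w * y⁻¹)) :
    cs.IsCuspidalPair (cs.minPair w).1 (cs.minPair w).2 := by
  refine ⟨⟨w, cs.mem_parabolic_Jset w, rfl⟩, ?_⟩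
  rintro K hK _ ⟨y, -, rfl⟩ hv
  obtain ⟨x, u, -, -, -, hx⟩ := cs.exists_isMinCosetRep_conj (z := y⁻¹) hv hw (by group)
  have heq : cs.parabolic K = cs.parabolic (cs.Jset w) :=
    Subgroup.eq_of_le_of_card_ge (cs.parabolic_mono hK.1) (cs.card_parabolic_le_of_conj hx)
  refine hK.2 fun i hi => cs.simple_mem_parabolic_iff.mp ?_
  rw [heq]
  exact cs.simple_mem_parabolic hi

theorem pairEquiv_minPair [Finite W] {w w' z : W}
    (hw : ∀ y, cs.length w ≤ cs.length (y * w * y⁻¹))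
    (hw' : ∀ y, cs.length w' ≤ cs.length (y * w' * y⁻¹)) (hz : w' = z * w * z⁻¹) :
    cs.PairEquiv (cs.minPair w) (cs.minPair w') := by
  obtain ⟨x, u, hu, hwx, hmin, hx⟩ :=
    cs.exists_isMinCosetRep_conj (cs.mem_parabolic_Jset w) hw' hz
  obtain ⟨x', u', -, -, -, hx'⟩ :=
    cs.exists_isMinCosetRep_conj (z := z⁻¹) (cs.mem_parabolic_Jset w') hw (by rw [hz]; group)
  have hcard := cs.card_parabolic_le_of_conj hx'
  have hmap : (cs.parabolic (cs.Jset w')).map (MulAut.conj x⁻¹).toMonoidHom =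
      cs.parabolic (cs.Jset w) := by
    refine Subgroup.eq_of_le_of_card_ge ?_ ?_
    · rintro _ ⟨y, hy, rfl⟩
      simpa using hx y hy
    · rwa [Subgroup.card_map_of_injective (MulAut.conj x⁻¹).injective]
  have hconj {y : W} (hy : y ∈ cs.parabolic (cs.Jset w)) :
      x * y * x⁻¹ ∈ cs.parabolic (cs.Jset w') := by
    rw [← hmap] at hy
    obtain ⟨r, hr, rfl⟩ := hy
    simpa [mul_assoc] using hr
  have hmin' : cs.IsMinCosetRep (cs.Jset w') x⁻¹ := by
    intro v hv
    have := hmin (x⁻¹ * v⁻¹ * x) (hx _ (inv_mem hv))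
    rw [length_inv, ← cs.length_inv (x⁻¹ * v)]
    simpa [mul_assoc] using this
  have hsimple {y : W} (I : Set B) (hy : y ∈ cs.parabolic I) (h1 : cs.length y ≤ 1)
      (hne : y ≠ 1) : ∃ j ∈ I, cs.simple j = y := by
    have h0 : cs.length y ≠ 0 := fun h => hne (cs.length_eq_zero_iff.mp h)
    obtain ⟨j, rfl⟩ := cs.length_eq_one_iff.mp (by lia : cs.length y = 1)
    exact ⟨j, cs.simple_mem_parabolic_iff.mp hy, rfl⟩
  have hne (i : B) : cs.simple i ≠ 1 := fun h => by
    simpa [h] using cs.length_simple i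
  refine ⟨x, ?_, ?_⟩
  · ext y
    simp only [minPair, Set.mem_image]
    constructor
    · rintro ⟨i, hi, rfl⟩
      have hm := hx _ (cs.simple_mem_parabolic hi)
      have hl := hmin.length_le_length_conj hm
      obtain ⟨j, hj, hji⟩ := hsimple _ hm
        (by simpa [mul_assoc] using hl) (by simpa [mul_assoc, mul_eq_one_iff_eq_inv] using hne i)
      exact ⟨_, ⟨j, hj, rfl⟩, by rw [hji]; group⟩
    · rintro ⟨_, ⟨i, hi, rfl⟩, rfl⟩
      have hm := hconj (cs.simple_mem_parabolic hi)
      have hl := hmin'.length_le_length_conj hm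
      exact hsimple _ hm (by simpa [mul_assoc] using hl)
        (by simpa [mul_assoc, mul_eq_one_iff_eq_inv] using hne i)
  · ext y
    simp only [minPair, conjClassIn, Set.mem_ofPred_eq, Set.mem_image]
    constructor
    · rintro ⟨a, ha, rfl⟩
      refine ⟨_, ⟨x⁻¹ * a * x * u, mul_mem (hx a ha) hu, rfl⟩, ?_⟩
      rw [hwx]
      group
    · rintro ⟨_, ⟨a, ha, rfl⟩, rfl⟩
      refine ⟨x * (a * u⁻¹) * x⁻¹, hconj (mul_mem ha (inv_mem hu)), ?_⟩
      rw [hwx]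
      group

/-- If conjugation by `x` sends the simple reflections in `I` onto those in `J(x c x⁻¹)`, then
it does not decrease the length of `c`. -/
theorem length_le_length_conj_of_image_eq {I : Set B} {c x : W}
    (h : cs.simple '' cs.Jset (x * c * x⁻¹) = (fun g => x * g * x⁻¹) '' (cs.simple '' I)) :
    cs.length c ≤ cs.length (x * c * x⁻¹) := by
  obtain ⟨ω, hω, hprod, hJ⟩ := cs.exists_reduced_word_Jset (x * c * x⁻¹)
  have key : ∀ ω : List B, (∀ i ∈ ω, i ∈ cs.Jset (x * c * x⁻¹)) →
      cs.length (x⁻¹ * cs.wordProd ω * x) ≤ ω.length := by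
    intro ω hJ
    induction ω with
    | nil => simp
    | cons i ω ih =>
      obtain ⟨_, ⟨j, -, rfl⟩, hj⟩ := h.subset ⟨i, hJ i (by simp), rfl⟩
      have : x⁻¹ * cs.wordProd (i :: ω) * x = cs.simple j * (x⁻¹ * cs.wordProd ω * x) := by
        rw [wordProd_cons, ← hj]; group
      rw [this, List.length_cons]
      have h1 := cs.length_mul_le (cs.simple j) (x⁻¹ * cs.wordProd ω * x)
      have h2 := ih fun k hk => hJ k (by simp [hk])
      rw [length_simple] at h1
      lia
  have := key ω hJ
  rw [← hω.eq, hprod] at this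
  simpa [mul_assoc] using this

theorem conjClassIn_eq_of_mem {H : Subgroup W} {w c : W} (hc : c ∈ conjClassIn H w) :
    conjClassIn H w = conjClassIn H c := by
  obtain ⟨y, hy, rfl⟩ := hc
  ext z
  constructor
  · rintro ⟨a, ha, rfl⟩
    exact ⟨a * y⁻¹, mul_mem ha (inv_mem hy), by group⟩
  · rintro ⟨a, ha, rfl⟩
    exact ⟨a * y, mul_mem ha hy, by group⟩

theorem IsCuspidalPair.eq_minPair {cs : CoxeterSystem M W} {p : Set B × Set W}
    (hp : cs.IsCuspidalPair p.1 p.2) {c : W} (hc : c ∈ p.2) : p = cs.minPair c := by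
  obtain ⟨⟨w, hw, hC⟩, hcusp⟩ := hp
  have hcI : c ∈ cs.parabolic p.1 := by
    rw [hC] at hc
    obtain ⟨y, hy, rfl⟩ := hc
    exact mul_mem (mul_mem hy hw) (inv_mem hy)
  have hJ : cs.Jset c = p.1 := by
    by_contra hne
    exact hcusp _ ((cs.Jset_subset_of_mem_parabolic hcI).ssubset_of_ne hne) c hc
      (cs.mem_parabolic_Jset c)
  refine Prod.ext hJ.symm ?_
  rw [minPair, hJ, hC]
  exact conjClassIn_eq_of_mem (hC ▸ hc)

end CoxeterSystem

/-- Let `C` be a conjugacy class of a finite Coxeter group `W`.  For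
`w ∈ C_min` let `π(w) = (J(w), C'_w)` where `C'_w` is the conjugacy class of `w` in `W_{J(w)}`.
Then: (i) for every `w ∈ C_min` the class `C'_w` is cuspidal in `W_{J(w)}`, so
`π(w) ∈ 𝓘(W,S)`; (ii) for any `w, w' ∈ C_min` one has `π(w) ∼ π(w')`; and (iii) every pair in
`𝓘(W,S)` that is `∼`-equivalent to `π(w)` for some `w ∈ C_min` is itself of the form `π(w')`
for some `w' ∈ C_min`. -/
theorem minPairs_form_equivalence_class {B W : Type*} [Group W] [Finite W]
    {M : CoxeterMatrix B} (cs : CoxeterSystem M W) (C : Set W) (hC : IsConjClassSet C) :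
    (∀ w ∈ cs.Cmin C, cs.IsCuspidalPair (cs.minPair w).1 (cs.minPair w).2) ∧
    (∀ w ∈ cs.Cmin C, ∀ w' ∈ cs.Cmin C, cs.PairEquiv (cs.minPair w) (cs.minPair w')) ∧
    (∀ p : Set B × Set W, cs.IsCuspidalPair p.1 p.2 →
      (∃ w ∈ cs.Cmin C, cs.PairEquiv p (cs.minPair w)) →
      ∃ w' ∈ cs.Cmin C, p = cs.minPair w') := by
  refine ⟨fun w hw => cs.isCuspidalPair_minPair (cs.length_le_conj_of_mem_Cmin hC hw),
    fun w hw w' hw' => ?_, ?_⟩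
  · have hconj : IsConj w w' := by
      obtain ⟨c, rfl⟩ := hC
      exact hw.1.symm.trans hw'.1
    obtain ⟨z, hz⟩ := isConj_iff.mp hconj
    exact cs.pairEquiv_minPair (cs.length_le_conj_of_mem_Cmin hC hw)
      (cs.length_le_conj_of_mem_Cmin hC hw') hz.symm
  · rintro p hp ⟨w, hw, x, hI, hcl⟩
    have hmem : w ∈ (cs.minPair w).2 := ⟨1, one_mem _, by simp⟩
    rw [hcl] at hmem
    obtain ⟨c, hc, rfl⟩ := hmem
    refine ⟨c, ⟨?_, fun y hy => ?_⟩, hp.eq_minPair hc⟩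
    · obtain ⟨d, rfl⟩ := hC
      exact hw.1.trans (isConj_iff.mpr ⟨x⁻¹, by group⟩)
    · exact (cs.length_le_length_conj_of_image_eq hI).trans (hw.2 y hy)
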